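/- arXiv:1505.05642 — 2 statements merged into one kernel-verified Lean document; each statement's English description precedes it below -/
import Mathlib

section
/- For every integer q ≥ 2 and every integer k ≥ 3, the Z_q-MacDonald code M_{k,k−1}(q) is a [q^{k−1}, k, d] Z_q-linear code, i.e. it has length q^{k−1}, exactly q^k codewords, and minimum Hamming distance d = 1 + (q − q/d₀ − 1)·(q^{k−1} − 1)/(q − 1) + (q^{k−2} − 1)/(q − 1), where d₀ > 1 is the smallest divisor of q. -/
/-- Hamming weight of a word over `ZMod q`: the number of nonzero coordinates. -/
def wt {q : ℕ} (l : List (ZMod q)) : ℕ := l.countP (fun x => decide (x ≠ 0))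

/-- The word `(c, α, c + α·𝟏, c + 2α·𝟏, …, c + (q−1)α·𝟏)`, where `𝟏` is the
all-ones vector of the same length as `c`. -/
def simplexWord (q : ℕ) (α : ZMod q) (c : List (ZMod q)) : List (ZMod q) :=
  c ++ α :: (List.range (q - 1)).flatMap (fun i => c.map (fun x => x + ((i + 1 : ℕ) : ZMod q) * α))

/-- The `ZMod q`-Simplex code `S_k(q)` of dimension `k`, as a set of words (lists):
`S_1(q) = ZMod q` (as length-1 words) and
`S_k(q) = {(c, α, c + α·𝟏, …, c + (q−1)α·𝟏) : c ∈ S_{k-1}(q), α ∈ ZMod q}`. -/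
def simplex (q : ℕ) : ℕ → Set (List (ZMod q))
  | 0 => {[]}
  | k + 1 => {w | ∃ c ∈ simplex q k, ∃ α : ZMod q, w = simplexWord q α c}

/-- The word `(α, c + α·𝟏, c + 2α·𝟏, …, c + (q−1)α·𝟏)`. -/
def macWord (q : ℕ) (α : ZMod q) (c : List (ZMod q)) : List (ZMod q) :=
  α :: (List.range (q - 1)).flatMap (fun i => c.map (fun x => x + ((i + 1 : ℕ) : ZMod q) * α))

/-- The `ZMod q`-MacDonald code `M_{k,k-1}(q)`, as a set of words:
`M_{k,k-1}(q) = {(α, c + α·𝟏, …, c + (q−1)α·𝟏) : α ∈ ZMod q, c ∈ S_{k-1}(q)}`. -/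
def macdonald (q k : ℕ) : Set (List (ZMod q)) :=
  {w | ∃ α : ZMod q, ∃ c ∈ simplex q (k - 1), w = macWord q α c}

/-- The sum of `f` over the letters of a word. -/
def wordSum {q : ℕ} (f : ZMod q → ℕ) (l : List (ZMod q)) : ℕ := (l.map f).sum

/-- The indicator function of the nonzero letters. -/
def letterWt {q : ℕ} (x : ZMod q) : ℕ := if x = 0 then 0 else 1

/-- The length `1 + q + ⋯ + q^(k-1)` of the words of `simplex q k`. -/
def repunit (q k : ℕ) : ℕ := ∑ i ∈ Finset.range k, q ^ i

section WordSum

variable {q : ℕ}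

theorem repunit_succ (k : ℕ) : repunit q (k + 1) = q * repunit q k + 1 :=
  geom_sum_succ

theorem repunit_succ' (k : ℕ) : repunit q (k + 1) = repunit q k + q ^ k :=
  Finset.sum_range_succ _ _

theorem repunit_eq_div (hq : 2 ≤ q) (k : ℕ) : repunit q k = (q ^ k - 1) / (q - 1) :=
  Nat.geomSum_eq hq k

theorem wt_eq_wordSum (l : List (ZMod q)) : wt l = wordSum letterWt l := by
  induction l with
  | nil => rfl
  | cons x l ih =>
    simp only [wt, wordSum, letterWt, List.countP_cons, List.map_cons, List.sum_cons] at ih ⊢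
    rw [ih]
    by_cases hx : x = 0 <;> simp [hx, add_comm]

theorem wordSum_mono {f g : ZMod q → ℕ} (h : ∀ x, f x ≤ g x) (l : List (ZMod q)) :
    wordSum f l ≤ wordSum g l :=
  List.sum_le_sum fun x _ => h x

theorem wordSum_add (f g : ZMod q → ℕ) (l : List (ZMod q)) :
    wordSum (fun x => f x + g x) l = wordSum f l + wordSum g l :=
  List.sum_map_add

theorem wordSum_const (n : ℕ) (l : List (ZMod q)) :
    wordSum (fun _ => n) l = n * l.length := by
  simp [wordSum, mul_comm]

theorem wordSum_const_mul (n : ℕ) (f : ZMod q → ℕ) (l : List (ZMod q)) :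
    wordSum (fun x => n * f x) l = n * wordSum f l := by
  simp [wordSum, List.sum_map_mul_left]

theorem wordSum_flatMap (f : ZMod q → ℕ) (g : ℕ → ZMod q → ZMod q) (c : List (ZMod q)) (n : ℕ) :
    wordSum f ((List.range n).flatMap fun i => c.map (g i)) =
      wordSum (fun x => ∑ i ∈ Finset.range n, f (g i x)) c := by
  induction n with
  | zero => simp [wordSum]
  | succ n ih =>
    simp only [Finset.sum_range_succ]
    rw [wordSum_add, ← ih]
    simp [wordSum, List.range_succ, Function.comp_def]

theorem sum_range_natCast [NeZero q] (f : ZMod q → ℕ) :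
    ∑ i ∈ Finset.range q, f (i : ZMod q) = ∑ i : ZMod q, f i := by
  refine Finset.sum_bij' (fun i _ => (i : ZMod q)) (fun i _ => i.val) ?_ ?_ ?_ ?_ ?_
  · simp
  · intro i _
    simpa using ZMod.val_lt i
  · intro i hi
    exact ZMod.val_cast_of_lt (by simpa using hi)
  · simp
  · simp

theorem simplexWord_eq_append (α : ZMod q) (c : List (ZMod q)) :
    simplexWord q α c = c ++ macWord q α c := rfl

theorem wordSum_simplexWord_eq_add (f : ZMod q → ℕ) (α : ZMod q) (c : List (ZMod q)) :
    wordSum f (simplexWord q α c) = wordSum f c + wordSum f (macWord q α c) := by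
  simp [wordSum, simplexWord_eq_append]

theorem wordSum_simplexWord [NeZero q] (f : ZMod q → ℕ) (α : ZMod q) (c : List (ZMod q)) :
    wordSum f (simplexWord q α c) = f α + wordSum (fun x => ∑ i : ZMod q, f (x + i * α)) c := by
  have hmac : wordSum f (macWord q α c) =
      f α + wordSum (fun x => ∑ i ∈ Finset.range (q - 1), f (x + ((i + 1 : ℕ) : ZMod q) * α)) c := by
    rw [← wordSum_flatMap]
    simp [wordSum, macWord]
  have hsum (x : ZMod q) : ∑ i : ZMod q, f (x + i * α) =
      (∑ i ∈ Finset.range (q - 1), f (x + ((i + 1 : ℕ) : ZMod q) * α)) + f x := by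
    rw [← sum_range_natCast (fun i : ZMod q => f (x + i * α))]
    obtain ⟨m, rfl⟩ := Nat.exists_eq_succ_of_ne_zero (NeZero.ne q)
    rw [Finset.sum_range_succ']
    simp
  simp only [hsum]
  rw [wordSum_simplexWord_eq_add, hmac, wordSum_add]
  ring

theorem wordSum_simplexWord_zero [NeZero q] (f : ZMod q → ℕ) (c : List (ZMod q)) :
    wordSum f (simplexWord q 0 c) = f 0 + q * wordSum f c := by
  rw [wordSum_simplexWord]
  simp [wordSum_const_mul]

theorem length_eq_wordSum (l : List (ZMod q)) : l.length = wordSum (fun _ => 1) l := by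
  simp [wordSum_const]

theorem length_of_mem_simplex [NeZero q] {k : ℕ} {c : List (ZMod q)} (hc : c ∈ simplex q k) :
    c.length = repunit q k := by
  induction k generalizing c with
  | zero => simp_all [simplex, repunit]
  | succ k ih =>
    obtain ⟨c, hc, α, rfl⟩ := hc
    rw [length_eq_wordSum, wordSum_simplexWord, repunit_succ, ← ih hc]
    simp [wordSum_const, add_comm]

theorem length_of_mem_macdonald [NeZero q] {k : ℕ} {w : List (ZMod q)} (hw : w ∈ macdonald q k) :
    w.length = q ^ (k - 1) := by
  obtain ⟨α, c, hc, rfl⟩ := hw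
  have h := length_of_mem_simplex (k := k - 1 + 1) ⟨c, hc, α, rfl⟩
  rw [simplexWord_eq_append, List.length_append, length_of_mem_simplex hc, repunit_succ'] at h
  omega

end WordSum

section Cardinality

variable {q : ℕ}

theorem simplex_succ_eq_image (k : ℕ) :
    simplex q (k + 1) =
      (fun p : List (ZMod q) × ZMod q => simplexWord q p.2 p.1) '' (simplex q k ×ˢ Set.univ) := by
  ext w
  simp [simplex, eq_comm]

theorem macdonald_eq_image (k : ℕ) :
    macdonald q k =
      (fun p : List (ZMod q) × ZMod q => macWord q p.2 p.1) '' (simplex q (k - 1) ×ˢ Set.univ) := by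
  ext w
  simp only [macdonald, Set.mem_ofPred_eq, Set.mem_image, Set.mem_prod, Set.mem_univ, and_true,
    Prod.exists]
  rw [exists_comm]
  simp [eq_comm]

theorem ncard_simplex [NeZero q] (k : ℕ) : (simplex q k).ncard = q ^ k := by
  induction k with
  | zero => simp [simplex]
  | succ k ih =>
    rw [simplex_succ_eq_image, Set.InjOn.ncard_image, Set.ncard_prod, ih, Set.ncard_univ,
      Nat.card_zmod, pow_succ]
    rintro ⟨c, α⟩ ⟨hc, -⟩ ⟨c', α'⟩ ⟨hc', -⟩ h
    have hlen := (length_of_mem_simplex hc).trans (length_of_mem_simplex hc').symm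
    obtain ⟨rfl, h⟩ := List.append_inj h hlen
    simp_all

theorem ncard_macdonald (hq : 2 ≤ q) {k : ℕ} (hk : 1 ≤ k) : (macdonald q k).ncard = q ^ k := by
  have : NeZero q := ⟨by omega⟩
  rw [macdonald_eq_image, Set.InjOn.ncard_image, Set.ncard_prod, ncard_simplex, Set.ncard_univ,
    Nat.card_zmod, ← pow_succ, Nat.sub_add_cancel hk]
  rintro ⟨c, α⟩ ⟨hc, -⟩ ⟨c', α'⟩ ⟨hc', -⟩ h
  have hlen := (length_of_mem_simplex hc).trans (length_of_mem_simplex hc').symm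
  obtain ⟨m, hm⟩ : ∃ m, q - 1 = m + 1 := ⟨q - 2, by omega⟩
  simp only [macWord, hm, List.range_succ_eq_map, List.flatMap_cons, List.cons.injEq] at h
  obtain ⟨rfl, h⟩ := h
  have h := (List.append_inj h (by simpa using hlen)).1
  rw [List.map_inj_right (fun x y hxy => add_right_cancel hxy)] at h
  simp [h]

end Cardinality

section Multiplication

variable {q : ℕ} [NeZero q]

/-- The number of `i : ZMod q` with `x + i * α = 0`. -/
def rootCount (α x : ZMod q) : ℕ := (Finset.univ.filter fun i : ZMod q => x + i * α = 0).card

theorem sum_letterWt_add_rootCount (α x : ZMod q) :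
    (∑ i : ZMod q, letterWt (x + i * α)) + rootCount α x = q := by
  have h := Finset.card_filter_add_card_filter_not (s := (Finset.univ : Finset (ZMod q)))
    (fun i => x + i * α = 0)
  rw [Finset.card_univ, ZMod.card] at h
  refine Eq.trans ?_ h
  rw [rootCount, add_comm]
  congr 1
  simp only [letterWt]
  rw [Finset.card_filter]
  exact Finset.sum_congr rfl fun i _ => by split_ifs <;> simp_all

theorem rootCount_le (α x : ZMod q) : rootCount α x ≤ rootCount α 0 := by
  obtain h | ⟨j, hj⟩ := (Finset.univ.filter fun i : ZMod q => x + i * α = 0).eq_empty_or_nonempty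
  · simp [rootCount, h]
  · refine Finset.card_le_card_of_injOn (fun i => i - j) ?_ (fun a _ b _ h => sub_left_injective h)
    intro i hi
    simp only [Finset.coe_filter, Finset.mem_filter, Finset.mem_univ, true_and,
      Set.mem_ofPred_eq] at hi hj ⊢
    linear_combination hi - hj

theorem rootCount_self (α : ZMod q) : rootCount α α = rootCount α 0 := by
  refine le_antisymm (rootCount_le α α) ?_
  refine Finset.card_le_card_of_injOn (fun i => i - 1) ?_ (fun a _ b _ h => sub_left_injective h)
  intro i hi
  simp only [Finset.coe_filter, Finset.mem_univ, true_and, Set.mem_ofPred_eq] at hi ⊢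
  linear_combination hi

theorem card_range_mul_rootCount (α : ZMod q) :
    Nat.card (AddMonoidHom.mulRight α).range * rootCount α 0 = q := by
  have h := (AddMonoidHom.mulRight α).ker.card_eq_card_quotient_mul_card_addSubgroup
  rw [Nat.card_zmod, Nat.card_congr
    (QuotientAddGroup.quotientKerEquivRange (AddMonoidHom.mulRight α)).toEquiv] at h
  refine Eq.trans ?_ h.symm
  congr 1
  rw [rootCount, Nat.card_eq_fintype_card, Fintype.card_subtype]
  simp [AddMonoidHom.mem_ker]

theorem rootCount_zero_le {α : ZMod q} (hα : α ≠ 0) : rootCount α 0 ≤ q / q.minFac := by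
  have h := card_range_mul_rootCount α
  have hne : Nat.card (AddMonoidHom.mulRight α).range ≠ 1 := by
    intro h1
    rw [AddSubgroup.card_eq_one] at h1
    have : α ∈ (AddMonoidHom.mulRight α).range := ⟨1, by simp⟩
    rw [h1] at this
    exact hα (by simpa using this)
  have hpos : Nat.card (AddMonoidHom.mulRight α).range ≠ 0 := Nat.card_pos.ne'
  rw [Nat.le_div_iff_mul_le (Nat.minFac_pos q)]
  calc rootCount α 0 * q.minFac
      ≤ rootCount α 0 * Nat.card (AddMonoidHom.mulRight α).range :=
        Nat.mul_le_mul_left _ (Nat.minFac_le_of_dvd (by omega) (Dvd.intro _ h))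
    _ = q := by rw [mul_comm, h]

theorem le_sum_letterWt {α : ZMod q} (hα : α ≠ 0) (x : ZMod q) :
    q - q / q.minFac ≤ ∑ i : ZMod q, letterWt (x + i * α) := by
  have h₁ := sum_letterWt_add_rootCount α x
  have h₂ := (rootCount_le α x).trans (rootCount_zero_le hα)
  omega

/-- A coset of a nonzero multiplication image is not contained in a set of fewer than
`q.minFac` elements. -/
theorem exists_add_mul_notMem {β : ZMod q} (hβ : β ≠ 0) (x : ZMod q) (s : Finset (ZMod q))
    (hs : s.card < q.minFac) : ∃ i : ZMod q, x + i * β ∉ s := by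
  by_contra! h
  have hcard := Finset.card_le_mul_card_image_of_maps_to (s := Finset.univ) (t := s)
    (f := fun i : ZMod q => x + i * β) (fun i _ => h i) (q / q.minFac) (by
      intro a _
      refine le_trans (le_of_eq ?_) ((rootCount_le β (x - a)).trans (rootCount_zero_le hβ))
      rw [rootCount]
      congr 1
      ext i
      simp only [Finset.mem_filter, Finset.mem_univ, true_and]
      constructor <;> intro hi <;> linear_combination hi)
  rw [Finset.card_univ, ZMod.card] at hcard
  have hq : 0 < q := NeZero.pos q
  have hdiv := Nat.div_mul_cancel (Nat.minFac_dvd q)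
  have hpos : 0 < q / q.minFac := Nat.div_pos (Nat.minFac_le hq) (Nat.minFac_pos q)
  nlinarith

theorem le_rootCount_div_minFac (q : ℕ) [NeZero q] :
    q / q.minFac ≤ rootCount ((q / q.minFac : ℕ) : ZMod q) 0 := by
  have hdiv := Nat.div_mul_cancel (Nat.minFac_dvd q)
  rw [← Finset.card_range (q / q.minFac), rootCount, Finset.card_range]
  refine Finset.card_le_card_of_injOn (s := Finset.range (q / q.minFac))
    (fun j => ((j * q.minFac : ℕ) : ZMod q)) ?_ ?_ |>.trans' (by simp)
  · intro j _
    simp only [Finset.coe_filter, Finset.mem_univ, true_and, Set.mem_ofPred_eq, zero_add]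
    rw [← Nat.cast_mul, mul_assoc, mul_comm q.minFac, hdiv]
    simp
  · intro i hi j hj hij
    have hlt {a : ℕ} (ha : a < q / q.minFac) : a * q.minFac < q := by
      calc a * q.minFac < q / q.minFac * q.minFac :=
            Nat.mul_lt_mul_of_pos_right ha (Nat.minFac_pos q)
        _ = q := hdiv
    simp only [Finset.coe_range, Set.mem_Iio] at hi hj
    have hij := (ZMod.natCast_eq_natCast_iff' _ _ _).1 hij
    rw [Nat.mod_eq_of_lt (hlt hi), Nat.mod_eq_of_lt (hlt hj)] at hij
    exact Nat.eq_of_mul_eq_mul_right (Nat.minFac_pos q) hij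

end Multiplication

section MinimumDistance

variable {q : ℕ}

theorem div_minFac_lt (hq : 2 ≤ q) : q / q.minFac < q :=
  Nat.div_lt_self (by omega) (Nat.minFac_prime (by omega)).one_lt

theorem div_minFac_pos (hq : 2 ≤ q) : 0 < q / q.minFac :=
  Nat.div_pos (Nat.minFac_le (by omega)) (Nat.minFac_pos q)

theorem le_wt_of_mem_simplex (hq : 2 ≤ q) {k : ℕ} {c : List (ZMod q)}
    (hc : c ∈ simplex q (k + 1)) (hwt : wt c ≠ 0) :
    1 + (q - q / q.minFac) * repunit q k ≤ wt c := by
  have : NeZero q := ⟨by omega⟩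
  induction k generalizing c with
  | zero =>
    simp only [repunit, Finset.range_zero, Finset.sum_empty, mul_zero]
    omega
  | succ k ih =>
    obtain ⟨c, hc, α, rfl⟩ := hc
    by_cases hα : α = 0
    · subst hα
      rw [wt_eq_wordSum, wordSum_simplexWord_zero, ← wt_eq_wordSum] at hwt ⊢
      simp only [letterWt, if_true, zero_add] at hwt ⊢
      have h := ih hc (right_ne_zero_of_mul hwt)
      have hlt := div_minFac_pos hq
      rw [repunit_succ]
      obtain ⟨t, ht⟩ : ∃ t, t = q - q / q.minFac := ⟨_, rfl⟩
      rw [← ht] at h ⊢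
      have : t + 1 ≤ q := by omega
      nlinarith
    · rw [wt_eq_wordSum, wordSum_simplexWord, ← length_of_mem_simplex hc, ← wordSum_const]
      have := wordSum_mono (le_sum_letterWt hα) c
      simp only [letterWt, hα, if_false] at this ⊢
      omega

theorem repunit_le_wordSum [NeZero q] {h : ZMod q → ℕ} (h_zero : 1 ≤ h 0)
    (h_coset : ∀ β ≠ 0, ∀ x, ∃ i : ZMod q, 1 ≤ h (x + i * β)) {k : ℕ} {c : List (ZMod q)}
    (hc : c ∈ simplex q (k + 1)) : repunit q k ≤ wordSum h c := by
  induction k generalizing c with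
  | zero => simp [repunit]
  | succ k ih =>
    obtain ⟨c, hc, β, rfl⟩ := hc
    by_cases hβ : β = 0
    · subst hβ
      rw [wordSum_simplexWord_zero, repunit_succ, add_comm]
      exact add_le_add h_zero (Nat.mul_le_mul_left _ (ih hc))
    · rw [wordSum_simplexWord, ← length_of_mem_simplex hc, length_eq_wordSum]
      refine (wordSum_mono (fun x => ?_) c).trans (Nat.le_add_left _ _)
      obtain ⟨i, hi⟩ := h_coset β hβ x
      exact hi.trans (Finset.single_le_sum (f := fun i : ZMod q => h (x + i * β))
        (fun _ _ => Nat.zero_le _) (Finset.mem_univ i))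

theorem wt_add_wt_macWord [NeZero q] (α : ZMod q) (c : List (ZMod q)) :
    wt c + wt (macWord q α c) =
      letterWt α + wordSum (fun x => ∑ i : ZMod q, letterWt (x + i * α)) c := by
  simp only [wt_eq_wordSum]
  rw [← wordSum_simplexWord_eq_add, wordSum_simplexWord]

/-- The contribution of a letter `x` to the weight of `macWord q α c` exceeds
`q - q / q.minFac - 1` by at least some `h x`, where `h` does not vanish at `0` or on any coset of
a nonzero multiplication image. -/
theorem exists_excess [NeZero q] (hq : 2 ≤ q) {α : ZMod q} (hα : α ≠ 0) :
    ∃ h : ZMod q → ℕ, 1 ≤ h 0 ∧ (∀ β ≠ 0, ∀ x, ∃ i : ZMod q, 1 ≤ h (x + i * β)) ∧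
      ∀ x, q - q / q.minFac - 1 + (h x + letterWt x) ≤
        ∑ i : ZMod q, letterWt (x + i * α) := by
  have hle := rootCount_zero_le hα
  have hpos := div_minFac_pos hq
  have hlt := div_minFac_lt hq
  have hδ (x : ZMod q) : letterWt x ≤ 1 := by
    unfold letterWt
    split_ifs <;> omega
  rcases hle.lt_or_eq with hr | hr
  · refine ⟨fun _ => 1, le_rfl, fun _ _ _ => ⟨0, le_rfl⟩, fun x => ?_⟩
    have h₁ := sum_letterWt_add_rootCount α x
    have h₂ := rootCount_le α x
    have h₃ := hδ x
    dsimp only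
    omega
  · classical
    let s : Finset (ZMod q) := (Finset.univ.image fun i : ZMod q => i * α).erase 0
    have hs : s.card < q.minFac := by
      have h := card_range_mul_rootCount α
      rw [hr] at h
      have hcard : Nat.card (AddMonoidHom.mulRight α).range = q.minFac :=
        Nat.eq_of_mul_eq_mul_right hpos (h.trans (Nat.mul_div_cancel' (Nat.minFac_dvd q)).symm)
      have himage : (Finset.univ.image fun i : ZMod q => i * α).card = q.minFac := by
        rw [← hcard, Nat.card_eq_fintype_card, Fintype.card_subtype]
        congr 1
        ext
        simp [AddMonoidHom.mem_range]
      rw [← himage]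
      exact Finset.card_erase_lt_of_mem (Finset.mem_image.2 ⟨0, Finset.mem_univ _, zero_mul α⟩)
    refine ⟨fun x => if x ∈ s then 0 else 1, by simp [s], fun β hβ x => ?_, fun x => ?_⟩
    · obtain ⟨i, hi⟩ := exists_add_mul_notMem hβ x s hs
      exact ⟨i, by simp [hi]⟩
    · have h₁ := sum_letterWt_add_rootCount α x
      have h₂ := rootCount_le α x
      have h₃ := hδ x
      by_cases hx : x = 0
      · simp only [hx, letterWt, s] at h₁ h₂ ⊢
        simp only [Finset.mem_erase, ne_eq, not_true_eq_false, false_and, if_false, if_true]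
        omega
      by_cases hxs : x ∈ s
      · simp only [hxs, if_true]
        omega
      · have h_zero : rootCount α x = 0 := by
          rw [rootCount, Finset.card_eq_zero, Finset.filter_eq_empty_iff]
          intro i _ hi
          exact hxs (Finset.mem_erase.2 ⟨hx, Finset.mem_image.2
            ⟨-i, Finset.mem_univ _, by linear_combination -hi⟩⟩)
        simp only [hxs, if_false]
        omega

theorem le_wt_macWord (hq : 2 ≤ q) {k : ℕ} {α : ZMod q} {c : List (ZMod q)}
    (hc : c ∈ simplex q (k + 2)) (hwt : wt (macWord q α c) ≠ 0) :
    1 + (q - q / q.minFac - 1) * repunit q (k + 2) + repunit q (k + 1) ≤ wt (macWord q α c) := by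
  have : NeZero q := ⟨by omega⟩
  have hmac := wt_add_wt_macWord α c
  by_cases hα : α = 0
  · subst hα
    have hW : wordSum (fun x => ∑ i : ZMod q, letterWt (x + i * 0)) c = q * wt c := by
      simp [wt_eq_wordSum, wordSum_const_mul]
    rw [hW] at hmac
    simp only [letterWt, if_true, zero_add] at hmac
    have hc0 : wt c ≠ 0 := by
      intro h
      simp_all
    have h := le_wt_of_mem_simplex hq hc hc0
    rw [repunit_succ (k + 1)]
    have hpos := div_minFac_pos hq
    have hlt := div_minFac_lt hq
    obtain ⟨t, ht⟩ : ∃ t, q - q / q.minFac = t + 1 := ⟨q - q / q.minFac - 1, by omega⟩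
    obtain ⟨s, hs⟩ : ∃ s, q = t + 2 + s := ⟨q - (t + 2), by omega⟩
    rw [ht] at h ⊢
    generalize repunit q (k + 1) = n at *
    generalize wt c = a at *
    generalize wt (macWord q 0 c) = b at *
    have hb : b = (t + 1 + s) * a := by
      rw [hs] at hmac
      linarith
    clear hW
    rw [hb, Nat.add_sub_cancel, hs]
    nlinarith [Nat.mul_le_mul_left (t + 1 + s) h, Nat.zero_le (n * s), Nat.zero_le (n * t)]
  · obtain ⟨h, h_zero, h_coset, hle⟩ := exists_excess hq hα
    have h₁ := wordSum_mono hle c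
    rw [wordSum_add, wordSum_add, wordSum_const, length_of_mem_simplex hc, ← wt_eq_wordSum] at h₁
    have h₂ := repunit_le_wordSum h_zero h_coset hc
    simp only [letterWt, hα, if_false] at hmac h₁
    omega

theorem exists_wordSum_eq [NeZero q] (α : ZMod q) (k : ℕ) :
    ∃ c ∈ simplex q (k + 1), ∀ f : ZMod q → ℕ, wordSum f c = f α * q ^ k + f 0 * repunit q k := by
  induction k with
  | zero =>
    refine ⟨_, ⟨[], rfl, α, rfl⟩, fun f => ?_⟩
    rw [wordSum_simplexWord]
    simp [wordSum, repunit]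
  | succ k ih =>
    obtain ⟨c, hc, h⟩ := ih
    refine ⟨_, ⟨c, hc, 0, rfl⟩, fun f => ?_⟩
    rw [wordSum_simplexWord_zero, h, repunit_succ]
    ring

theorem exists_wt_macWord_eq (hq : 2 ≤ q) (k : ℕ) :
    ∃ α, ∃ c ∈ simplex q (k + 1), wt (macWord q α c) =
      1 + (q - q / q.minFac - 1) * repunit q (k + 1) + repunit q k := by
  have : NeZero q := ⟨by omega⟩
  have hpos := div_minFac_pos hq
  have hlt := div_minFac_lt hq
  set α : ZMod q := ((q / q.minFac : ℕ) : ZMod q) with hαdef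
  have hα : α ≠ 0 := by
    rw [hαdef, Ne, ZMod.natCast_eq_zero_iff]
    exact Nat.not_dvd_of_pos_of_lt hpos hlt
  obtain ⟨c, hc, hsum⟩ := exists_wordSum_eq α k
  refine ⟨α, c, hc, ?_⟩
  have hr : rootCount α 0 = q / q.minFac :=
    le_antisymm (rootCount_zero_le hα) (le_rootCount_div_minFac q)
  have h₀ := sum_letterWt_add_rootCount α 0
  have h₁ := sum_letterWt_add_rootCount α α
  rw [rootCount_self] at h₁
  rw [hr] at h₀ h₁
  have hmac := wt_add_wt_macWord α c
  rw [wt_eq_wordSum c, hsum, hsum, Nat.eq_sub_of_add_eq h₀, Nat.eq_sub_of_add_eq h₁] at hmac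
  simp only [letterWt, hα, if_true, if_false] at hmac
  obtain ⟨t, ht⟩ : ∃ t, q - q / q.minFac = t + 1 := ⟨q - q / q.minFac - 1, by omega⟩
  rw [ht] at hmac ⊢
  rw [repunit_succ', Nat.add_sub_cancel]
  linarith

end MinimumDistance

/-- The `ZMod q`-MacDonald code `M_{k,k−1}(q)` is a
`[q^{k−1}, k, 1 + (q − q/d₀ − 1)·(q^{k−1} − 1)/(q − 1) + (q^{k−2} − 1)/(q − 1)]`
`ZMod q`-linear code, where `d₀ > 1` is the smallest divisor of `q`. -/
theorem macdonald_params (q k : ℕ) (hq : 2 ≤ q) (hk : 3 ≤ k) :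
    (∀ w ∈ macdonald q k, w.length = q ^ (k - 1)) ∧
    (macdonald q k).ncard = q ^ k ∧
    IsLeast {m | ∃ w ∈ macdonald q k, wt w ≠ 0 ∧ wt w = m}
      (1 + (q - q / q.minFac - 1) * ((q ^ (k - 1) - 1) / (q - 1))
        + (q ^ (k - 2) - 1) / (q - 1)) := by
  have : NeZero q := ⟨by omega⟩
  refine ⟨fun w hw => length_of_mem_macdonald hw, ncard_macdonald hq (by omega), ?_⟩
  rw [← repunit_eq_div hq, ← repunit_eq_div hq]
  obtain ⟨k, rfl⟩ : ∃ m, k = m + 3 := ⟨k - 3, by omega⟩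
  constructor
  · obtain ⟨α, c, hc, h⟩ := exists_wt_macWord_eq hq (k + 1)
    exact ⟨_, ⟨α, c, hc, rfl⟩, by omega, h⟩
  · rintro _ ⟨_, ⟨α, c, hc, rfl⟩, hwt, rfl⟩
    exact le_wt_macWord hq hc hwt
end

section
/- For every integer q ≥ 2, the distribution of the number z(c) of zero coordinates among the q^2 codewords c of the Z_q-Simplex code S_2(q) is: exactly 1 codeword (the zero word) with z(c) = q + 1; exactly d·φ(d) codewords with z(c) = q/d, for each divisor d of q with d ≠ 1 and d ≠ q; exactly q·φ(q) + q − 1 codewords with z(c) = 1; and exactly q(q − 1) − Σ_{d | q, d ≠ 1} d·φ(d) codewords with z(c) = 0, where φ is Euler's totient function. -/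
/-- The codewords of the two-dimensional Simplex code are `(c, α, c + α, …, c + (q - 1)α)`. -/
lemma simplexWord_singleton (q : ℕ) (c α : ZMod q) :
    simplexWord q α [c] =
      c :: α :: (List.range (q - 1)).map (fun i => c + ((i + 1 : ℕ) : ZMod q) * α) := by
  simp [simplexWord, List.map_eq_flatMap]

lemma simplex_two_eq_range (q : ℕ) :
    simplex q 2 = Set.range (fun p : ZMod q × ZMod q => simplexWord q p.2 [p.1]) := by
  ext w
  have h : ∀ a : ZMod q, simplexWord q a [] = [a] := fun a => by
    simp [simplexWord, List.flatMap_eq_nil_iff]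
  simp only [simplex, Set.mem_ofPred_eq, Set.mem_singleton_iff, Set.mem_range,
    Prod.exists]
  constructor
  · rintro ⟨_, ⟨_, rfl, c, rfl⟩, α, rfl⟩
    exact ⟨c, α, by rw [h]⟩
  · rintro ⟨c, α, rfl⟩
    exact ⟨[c], ⟨[], rfl, c, (h c).symm⟩, α, rfl⟩

lemma simplexWord_singleton_injective (q : ℕ) :
    Function.Injective (fun p : ZMod q × ZMod q => simplexWord q p.2 [p.1]) := by
  rintro ⟨c, α⟩ ⟨c', α'⟩ h
  simp only [simplexWord_singleton, List.cons.injEq] at h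
  exact Prod.ext h.1 h.2.1

/-- Zeros of a codeword, counted on the coordinates `c + iα` with `i < q`, and on `α`. -/
lemma count_zero_simplexWord_singleton (q : ℕ) (hq : 0 < q) (c α : ZMod q) :
    (simplexWord q α [c]).count 0 =
      Nat.count (fun i : ℕ => c + (i : ZMod q) * α = 0) q + if α = 0 then 1 else 0 := by
  obtain ⟨n, rfl⟩ : ∃ n, q = n + 1 := ⟨q - 1, by omega⟩
  rw [simplexWord_singleton, Nat.count_succ']
  simp only [List.count_cons, beq_iff_eq, Nat.add_sub_cancel, Nat.cast_zero, zero_mul, add_zero]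
  simp only [List.count, List.countP_map, Nat.count, Function.comp_def, beq_eq_decide]
  omega

lemma count_add_mul_eq_zero (q : ℕ) (c α : ZMod q) [Decidable (c ∈ AddSubgroup.zmultiples α)]
    (hq : 0 < q) :
    Nat.count (fun i : ℕ => c + (i : ZMod q) * α = 0) q =
      if c ∈ AddSubgroup.zmultiples α then q / addOrderOf α else 0 := by
  have : NeZero q := ⟨hq.ne'⟩
  have hd : addOrderOf α ∣ q := by
    simpa [ZMod.card] using addOrderOf_dvd_card (x := α)
  split_ifs with hc
  · obtain ⟨k, hk⟩ : ∃ k : ℕ, k • α = -c := by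
      rw [← AddSubgroup.neg_mem_iff, ← mem_multiples_iff_mem_zmultiples] at hc
      exact hc
    have h : ∀ i : ℕ, c + (i : ZMod q) * α = 0 ↔ i ≡ k [MOD addOrderOf α] := by
      intro i
      rw [← nsmul_eq_nsmul_iff_modEq, hk, nsmul_eq_mul, eq_neg_iff_add_eq_zero, add_comm]
    simp only [h]
    rw [Nat.count_modEq_card _ (addOrderOf_pos α), Nat.mod_eq_zero_of_dvd hd]
    simp
  · rw [Nat.count_eq_card_filter_range, Finset.card_eq_zero, Finset.filter_eq_empty_iff]
    intro i _ h
    refine hc (AddSubgroup.neg_mem_iff _ |>.1 ?_)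
    rw [← eq_neg_iff_add_eq_zero.2 ((add_comm _ _).trans h), ← nsmul_eq_mul]
    exact AddSubgroup.nsmul_mem _ (AddSubgroup.mem_zmultiples α) i

open Classical in
/-- The number of codewords with `m` zeros, in terms of the parameters `(c, α)`. -/
lemma ncard_simplex_two_count_zero (q : ℕ) [NeZero q] (m : ℕ) :
    ({w ∈ simplex q 2 | w.count 0 = m}).ncard =
      (Finset.univ.filter (fun p : ZMod q × ZMod q =>
        (if p.1 ∈ AddSubgroup.zmultiples p.2 then q / addOrderOf p.2 else 0) +
          (if p.2 = 0 then 1 else 0) = m)).card := by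
  have h : {w ∈ simplex q 2 | w.count 0 = m} =
      (fun p : ZMod q × ZMod q => simplexWord q p.2 [p.1]) ''
        {p | (simplexWord q p.2 [p.1]).count 0 = m} := by
    rw [simplex_two_eq_range]
    ext w
    constructor
    · rintro ⟨⟨p, rfl⟩, hp⟩
      exact ⟨p, hp, rfl⟩
    · rintro ⟨p, hp, rfl⟩
      exact ⟨⟨p, rfl⟩, hp⟩
  rw [h, Set.ncard_image_of_injective _ (simplexWord_singleton_injective q),
    ← Set.ncard_coe_finset]
  congr 1
  ext p
  simp [count_zero_simplexWord_singleton q (NeZero.pos q),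
    count_add_mul_eq_zero q _ _ (NeZero.pos q)]

open Classical in
/-- Pairs `(c, α)` with `α` of additive order `d` and `c` a multiple of `α`. -/
lemma card_filter_addOrderOf_mem_zmultiples (q : ℕ) [NeZero q] (d : ℕ) (hd : d ∣ q) :
    (Finset.univ.filter (fun p : ZMod q × ZMod q =>
      addOrderOf p.2 = d ∧ p.1 ∈ AddSubgroup.zmultiples p.2)).card = d * Nat.totient d := by
  have hφ : (Finset.univ.filter (fun α : ZMod q => addOrderOf α = d)).card = d.totient :=
    IsAddCyclic.card_addOrderOf_eq_totient (by simpa [ZMod.card] using hd)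
  rw [Finset.card_eq_sum_card_fiberwise (f := Prod.snd)
    (t := Finset.univ.filter (fun α : ZMod q => addOrderOf α = d)) (by intro p; simp; tauto),
    Finset.sum_const_nat (m := d), hφ, mul_comm]
  intro α hα
  rw [Finset.mem_filter] at hα
  have hcard : (Finset.univ.filter (fun c : ZMod q => c ∈ AddSubgroup.zmultiples α)).card = d := by
    rw [← hα.2, ← Nat.card_zmultiples, Nat.card_eq_fintype_card, Fintype.card_subtype]
  refine Eq.trans ?_ hcard
  refine Finset.card_bij' (fun p _ => p.1) (fun c _ => (c, α)) ?_ ?_ ?_ ?_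
  · rintro ⟨c, β⟩ h
    simp only [Finset.mem_filter, Finset.mem_univ, true_and] at h ⊢
    exact h.2 ▸ h.1.2
  · intro c h
    simp only [Finset.mem_filter, Finset.mem_univ, true_and] at h ⊢
    exact ⟨⟨hα.2, h⟩, trivial⟩
  · rintro ⟨c, β⟩ h
    simp only [Finset.mem_filter] at h
    exact Prod.ext rfl h.2.symm
  · intro c h
    rfl

/-- The distribution of the number of zero coordinates among the codewords of the
`ZMod q`-Simplex code of dimension 2: exactly 1 codeword has `q + 1` zeros, exactly
`d·φ(d)` codewords have `q/d` zeros for each divisor `d` of `q` with `d ≠ 1, d ≠ q`,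
exactly `q·φ(q) + q − 1` codewords have 1 zero, and exactly
`q(q − 1) − Σ_{d ∣ q, d ≠ 1} d·φ(d)` codewords have no zero. -/
theorem simplex_two_zero_distribution (q : ℕ) (hq : 2 ≤ q) :
    ({w ∈ simplex q 2 | w.count 0 = q + 1}).ncard = 1 ∧
    (∀ d : ℕ, d ∣ q → d ≠ 1 → d ≠ q →
      ({w ∈ simplex q 2 | w.count 0 = q / d}).ncard = d * Nat.totient d) ∧
    ({w ∈ simplex q 2 | w.count 0 = 1}).ncard = q * Nat.totient q + q - 1 ∧
    ({w ∈ simplex q 2 | w.count 0 = 0}).ncard =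
      q * (q - 1) - ∑ d ∈ q.divisors.filter (fun d => d ≠ 1), d * Nat.totient d := by
  classical
  have : NeZero q := ⟨by omega⟩
  have hdvd : ∀ α : ZMod q, addOrderOf α ∣ q := fun α => by
    simpa [ZMod.card] using addOrderOf_dvd_card (x := α)
  have hdiv : ∀ (α : ZMod q) (d : ℕ), d ∣ q → (q / addOrderOf α = q / d ↔ addOrderOf α = d) :=
    fun α d hd => ⟨fun h => by
      rw [← Nat.div_div_self (hdvd α) (by omega), h, Nat.div_div_self hd (by omega)],
      fun h => by rw [h]⟩
  have hpos : ∀ d : ℕ, d ∣ q → 0 < q / d := fun d hd =>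
    Nat.div_pos (Nat.le_of_dvd (by omega) hd) (Nat.pos_of_dvd_of_pos hd (by omega))
  refine ⟨?_, ?_, ?_, ?_⟩
  · rw [ncard_simplex_two_count_zero, Finset.card_eq_one]
    refine ⟨(0, 0), ?_⟩
    ext ⟨c, α⟩
    simp only [Finset.mem_filter, Finset.mem_univ, true_and, Finset.mem_singleton, Prod.mk.injEq]
    by_cases hα : α = 0
    · subst hα
      by_cases hc : c = 0 <;> simp [hc]
      omega
    · have := Nat.div_le_self q (addOrderOf α)
      split_ifs <;> simp [hα] <;> omega
  · intro d hd hd1 hdq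
    rw [ncard_simplex_two_count_zero, ← card_filter_addOrderOf_mem_zmultiples q d hd]
    congr 1
    ext ⟨c, α⟩
    simp only [Finset.mem_filter, Finset.mem_univ, true_and]
    have hp := hpos d hd
    by_cases hα : α = 0
    · subst hα
      have h1 : q / d ≤ q := Nat.div_le_self q d
      have h2 : q / d ≠ 1 := fun h => hdq (by simpa [h] using Nat.div_mul_cancel hd)
      by_cases hc : c = 0 <;> simp [hc] <;> omega
    · by_cases hc : c ∈ AddSubgroup.zmultiples α
      · simp [hα, hc, hdiv α d hd]
      · simp only [hα, hc, if_false, and_false, iff_false]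
        omega
  · have hzero : (Finset.univ.filter (fun p : ZMod q × ZMod q => p.1 ≠ 0 ∧ p.2 = 0)).card
        = q - 1 := by
      have : Finset.univ.filter (fun p : ZMod q × ZMod q => p.1 ≠ 0 ∧ p.2 = 0) =
          (Finset.univ.erase (0 : ZMod q)) ×ˢ {0} := by
        ext ⟨c, α⟩
        simp only [Finset.mem_filter, Finset.mem_product, Finset.mem_erase, Finset.mem_univ,
          Finset.mem_singleton, true_and, and_true]
      rw [this, Finset.card_product, Finset.card_erase_of_mem (Finset.mem_univ _)]
      simp [ZMod.card]
    rw [ncard_simplex_two_count_zero, Nat.add_sub_assoc (by omega), ← hzero,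
      ← card_filter_addOrderOf_mem_zmultiples q q dvd_rfl, ← Finset.card_union_of_disjoint]
    · congr 1
      ext ⟨c, α⟩
      simp only [Finset.mem_filter, Finset.mem_univ, true_and, Finset.mem_union]
      by_cases hα : α = 0
      · subst hα
        by_cases hc : c = 0 <;> simp [hc] <;> omega
      · have h := hdiv α q dvd_rfl
        rw [Nat.div_self (by omega)] at h
        by_cases hc : c ∈ AddSubgroup.zmultiples α <;> simp [hα, hc, h]
    · rw [Finset.disjoint_filter]
      rintro ⟨c, α⟩ - h h'
      obtain ⟨-, rfl⟩ : c ≠ 0 ∧ α = 0 := h'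
      have := h.1
      simp at this
      omega
  · have hsum : (Finset.univ.filter (fun p : ZMod q × ZMod q =>
        p.2 ≠ 0 ∧ p.1 ∈ AddSubgroup.zmultiples p.2)).card =
        ∑ d ∈ q.divisors.filter (fun d => d ≠ 1), d * Nat.totient d := by
      rw [Finset.card_eq_sum_card_fiberwise (f := fun p => addOrderOf p.2)
        (t := q.divisors.filter (fun d => d ≠ 1))]
      · refine Finset.sum_congr rfl fun d hd => ?_
        simp only [Finset.mem_filter, Nat.mem_divisors] at hd
        rw [← card_filter_addOrderOf_mem_zmultiples q d hd.1.1, Finset.filter_filter]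
        congr 1
        ext ⟨c, α⟩
        simp only [Finset.mem_filter, Finset.mem_univ, true_and]
        constructor
        · tauto
        · rintro ⟨h, hc⟩
          refine ⟨⟨?_, hc⟩, h⟩
          rintro rfl
          exact hd.2 (by simpa using h.symm)
      · rintro ⟨c, α⟩ h
        have hα : α ≠ 0 := (Finset.mem_filter.1 h).2.1
        simp [hα, hdvd α]
        omega
    have htotal : (Finset.univ.filter (fun p : ZMod q × ZMod q => p.2 ≠ 0)).card =
        q * (q - 1) := by
      have : Finset.univ.filter (fun p : ZMod q × ZMod q => p.2 ≠ 0) =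
          Finset.univ ×ˢ (Finset.univ.erase (0 : ZMod q)) := by
        ext ⟨c, α⟩
        simp only [Finset.mem_filter, Finset.mem_product, Finset.mem_erase, Finset.mem_univ,
          true_and, and_true]
      rw [this, Finset.card_product, Finset.card_erase_of_mem (Finset.mem_univ _)]
      simp [ZMod.card]
    have hsplit := Finset.card_filter_add_card_filter_not
      (s := Finset.univ.filter (fun p : ZMod q × ZMod q => p.2 ≠ 0))
      (fun p => p.1 ∈ AddSubgroup.zmultiples p.2)
    rw [Finset.filter_filter, Finset.filter_filter, hsum, htotal] at hsplit
    rw [ncard_simplex_two_count_zero, ← hsplit, Nat.add_sub_cancel_left]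
    congr 1
    ext ⟨c, α⟩
    simp only [Finset.mem_filter, Finset.mem_univ, true_and]
    have := (hpos _ (hdvd α)).ne'
    by_cases hα : α = 0
    · simp [hα]
    · by_cases hc : c ∈ AddSubgroup.zmultiples α
      · simpa [hα, hc] using this
      · simp [hα, hc]
end
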